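/- arXiv:math/0405375 — 5 statements merged into one kernel-verified Lean document; each statement's English description precedes it below -/
import Mathlib

section
/- For every field k and every integer n ≥ 2, the images in Q_n of the normal monomials form a k-vector-space basis of Q_n. -/
/-!
STATEMENT 5: For every field `k` and every integer `n ≥ 2`, the images in `Q_n` of the
normal monomials form a `k`-vector-space basis of `Q_n`. A monomial is normal if it is of
the form `S_{A^1}^{j_1} ⋯ S_{A^m}^{j_m}` (`m ≥ 0`, empty product being `1`), where each
block is a genuine `S`-monomial (`A^i` nonempty, `0 ≤ j_i ≤ |A^i| − 1`) and, for every
`1 ≤ i < m`, either `A^{i+1} ⊄ A^i` or `|A^{i+1}| ≠ |A^i| − j_i − 1`.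
-/

noncomputable section

open Finset

/-- Index type for generators: nonempty subsets `A ⊆ I_n = {1,…,n}` (modeled as `Fin n`). -/
abbrev SubsetIdx (n : ℕ) := {A : Finset (Fin n) // A.Nonempty}

/-- The free associative unital `k`-algebra `F` on the generators `r_A`. -/
abbrev FreeA (k : Type) [Field k] (n : ℕ) := FreeAlgebra k (SubsetIdx n)

/-- The generator `r_A`, with the convention `r_∅ = 0`. -/
def rGen (k : Type) [Field k] (n : ℕ) (A : Finset (Fin n)) : FreeA k n :=
  if h : A.Nonempty then FreeAlgebra.ι k (⟨A, h⟩ : SubsetIdx n) else 0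

/-- The quadratic relation `f_{A;i,j}` defining `Q_n`. -/
def fRel (k : Type) [Field k] (n : ℕ) (A : Finset (Fin n)) (i j : Fin n) : FreeA k n :=
  rGen k n A * (rGen k n (A.erase i) - rGen k n (A.erase j))
    + (rGen k n (A.erase i) - rGen k n (A.erase j)) * rGen k n ((A.erase i).erase j)
    - rGen k n (A.erase i) ^ 2 + rGen k n (A.erase j) ^ 2

/-- The relation identifying each `f_{A;i,j}` (for `i, j ∈ A`) with `0`. -/
inductive QnRel (k : Type) [Field k] (n : ℕ) : FreeA k n → FreeA k n → Prop
  | rel (A : Finset (Fin n)) (i j : Fin n) (hi : i ∈ A) (hj : j ∈ A) :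
      QnRel k n (fRel k n A i j) 0

/-- The algebra `Q_n`. -/
abbrev Qn (k : Type) [Field k] (n : ℕ) := RingQuot (QnRel k n)

/-- The quotient map `F → Q_n`. -/
def QnMk (k : Type) [Field k] (n : ℕ) : FreeA k n →ₐ[k] Qn k n :=
  RingQuot.mkAlgHom k (QnRel k n)

/-- `A` with its minimal element removed (`∅` if `A = ∅`). -/
def eraseMin {n : ℕ} (A : Finset (Fin n)) : Finset (Fin n) :=
  if h : A.Nonempty then A.erase (A.min' h) else ∅

/-- The monomial `S_A^t = r_A · r_{A∖{a_1}} · r_{A∖{a_1,a_2}} ⋯ r_{A∖{a_1,…,a_t}}`,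
a product of `t+1` generators. -/
def SMon (k : Type) [Field k] (n : ℕ) : ℕ → Finset (Fin n) → FreeA k n
  | 0, A => rGen k n A
  | (t+1), A => rGen k n A * SMon k n t (eraseMin A)

/-- A word, encoded as the list of pairs `(A^i, j_i)`, is normal iff every block `(A, j)` is
a genuine `S`-monomial (`A` nonempty, `j + 1 ≤ |A|`) and consecutive blocks `(A, j)`,
`(A', j')` satisfy `A' ⊄ A` or `|A'| ≠ |A| − j − 1`. -/
def IsNormalWord (n : ℕ) (l : List (Finset (Fin n) × ℕ)) : Prop :=
  (∀ p ∈ l, p.1.Nonempty ∧ p.2 + 1 ≤ p.1.card) ∧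
    List.Chain' (fun p q : Finset (Fin n) × ℕ =>
      ¬ q.1 ⊆ p.1 ∨ q.1.card ≠ p.1.card - p.2 - 1) l

/-- The monomial `S_{A^1}^{j_1} ⋯ S_{A^m}^{j_m} ∈ F` encoded by a word. -/
def wordVal (k : Type) [Field k] (n : ℕ) (l : List (Finset (Fin n) × ℕ)) : FreeA k n :=
  (l.map (fun p => SMon k n p.2 p.1)).prod

section Recurrence

variable {k : Type*} [CommRing k] {M M' : Type*} [AddCommGroup M] [Module k M]
  [AddCommGroup M'] [Module k M']

/-- The sequences satisfying the order-`d` linear recurrence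
`f (m + d) = ∑ i < d, e i (f (m + d - 1 - i))` with operator coefficients. -/
def solSpace (e : ℕ → Module.End k M) (d : ℕ) : Submodule k (ℕ → M) where
  carrier := {f | ∀ m, f (m + d) = ∑ i ∈ range d, e i (f (m + d - 1 - i))}
  add_mem' := by
    intro f g hf hg m
    simp only [Set.mem_ofPred_eq] at hf hg
    simp [hf m, hg m, sum_add_distrib]
  zero_mem' := by intro m; simp
  smul_mem' := by
    intro c f hf m
    simp only [Set.mem_ofPred_eq] at hf
    simp [hf m, smul_sum]

theorem solSpace_shift {e : ℕ → Module.End k M} {d : ℕ} {f : ℕ → M} (hf : f ∈ solSpace e d)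
    (m : ℕ) : (fun i => f (m + i)) ∈ solSpace e d := by
  intro i
  have h := hf (m + i)
  rw [add_assoc] at h
  refine h.trans (sum_congr rfl fun x hx => ?_)
  have := mem_range.1 hx
  congr 2
  omega

theorem solSpace_map {e : ℕ → Module.End k M} {e' : ℕ → Module.End k M'} {d : ℕ} {f : ℕ → M}
    (T : M →ₗ[k] M') (hT : ∀ i y, T (e i y) = e' i (T y)) (hf : f ∈ solSpace e d) :
    (fun m => T (f m)) ∈ solSpace e' d := by
  intro m
  simp only [hf m, map_sum, hT]

theorem solSpace_ext {e : ℕ → Module.End k M} {d : ℕ} {f g : ℕ → M} (hf : f ∈ solSpace e d)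
    (hg : g ∈ solSpace e d) (h : ∀ m < d, f m = g m) : f = g := by
  funext m
  induction m using Nat.strong_induction_on with
  | _ m ih =>
    rcases lt_or_ge m d with hm | hm
    · exact h m hm
    · obtain ⟨c, rfl⟩ := Nat.exists_eq_add_of_le' hm
      rw [hf c, hg c]
      refine sum_congr rfl fun i hi => ?_
      have := mem_range.1 hi
      rw [ih _ (by omega)]

/-- The solution of the recurrence with initial values `x`. -/
def solve (e : ℕ → Module.End k M) (d : ℕ) (x : ℕ → M) (m : ℕ) : M :=
  if m < d then x m else ∑ i : Fin d, e i (solve e d x (m - 1 - i))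
termination_by m
decreasing_by have := i.2; omega

theorem solve_of_lt (e : ℕ → Module.End k M) {d : ℕ} (x : ℕ → M) {m : ℕ} (hm : m < d) :
    solve e d x m = x m := by
  rw [solve, if_pos hm]

theorem solve_mem (e : ℕ → Module.End k M) (d : ℕ) (x : ℕ → M) :
    solve e d x ∈ solSpace e d := by
  intro m
  rw [solve, if_neg (by omega), sum_range]

/-- The solution whose only nonzero initial value is `z`, at position `d - 1 - l`. -/
def fund (e : ℕ → Module.End k M) (d l : ℕ) : M →ₗ[k] (ℕ → M) where
  toFun z := solve e d (Pi.single (d - 1 - l) z)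
  map_add' y z := by
    refine solSpace_ext (solve_mem _ _ _)
      (Submodule.add_mem _ (solve_mem _ _ _) (solve_mem _ _ _)) fun m hm => ?_
    simp [solve_of_lt _ _ hm, Pi.single_add]
  map_smul' c z := by
    refine solSpace_ext (solve_mem _ _ _)
      (Submodule.smul_mem _ _ (solve_mem _ _ _)) fun m hm => ?_
    simp [solve_of_lt _ _ hm, Pi.single_smul]

theorem fund_mem (e : ℕ → Module.End k M) (d l : ℕ) (z : M) : fund e d l z ∈ solSpace e d :=
  solve_mem _ _ _

theorem fund_of_lt (e : ℕ → Module.End k M) {d : ℕ} (l : ℕ) (z : M) {m : ℕ} (hm : m < d) :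
    fund e d l z m = if m = d - 1 - l then z else 0 := by
  change solve _ _ _ _ = _
  rw [solve_of_lt _ _ hm, Pi.single_apply]

theorem fund_of_lt_of_ne (e : ℕ → Module.End k M) {d : ℕ} (l : ℕ) (z : M) {m : ℕ} (hm : m < d)
    (h : m ≠ d - 1 - l) : fund e d l z m = 0 := by
  rw [fund_of_lt _ _ _ hm, if_neg h]

theorem fund_init (e : ℕ → Module.End k M) {d l : ℕ} (z : M) (hl : l < d) :
    fund e d l z (d - 1 - l) = z := by
  rw [fund_of_lt _ _ _ (by omega), if_pos rfl]

theorem fund_self (e : ℕ → Module.End k M) {d l : ℕ} (z : M) (hl : l < d) :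
    fund e d l z d = e l z := by
  have h := fund_mem e d l z 0
  rw [zero_add] at h
  rw [h, sum_eq_single l]
  · rw [fund_init e z hl]
  · intro i hi hne
    have := mem_range.1 hi
    rw [fund_of_lt_of_ne _ _ _ (by omega) (by omega), map_zero]
  · intro h
    exact absurd (mem_range.2 hl) h

theorem eq_sum_fund {e : ℕ → Module.End k M} {d : ℕ} {f : ℕ → M} (hf : f ∈ solSpace e d) :
    f = ∑ l ∈ range d, fund e d l (f (d - 1 - l)) := by
  refine solSpace_ext hf (Submodule.sum_mem _ fun l _ => fund_mem _ _ _ _) fun m hm => ?_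
  rw [Finset.sum_apply, sum_eq_single (d - 1 - m)]
  · rw [fund_of_lt _ _ _ hm, if_pos (by omega)]
    congr 1
    omega
  · intro i hi hne
    have := mem_range.1 hi
    exact fund_of_lt_of_ne _ _ _ hm (by omega)
  · intro h
    exact absurd (mem_range.2 (by omega)) h

theorem sum_range_eq_of_init (e : ℕ → Module.End k M) {f : ℕ → M} {du dv j l : ℕ}
    (hd : du + j + 1 = dv) (hl : l < du) (hf : ∀ m < du, m ≠ du - 1 - l → f m = 0) :
    ∑ i ∈ range dv, e i (f (dv - 1 - i)) =
      ∑ i ∈ range j, e i (f (dv - 1 - i)) + e j (f du) + e (j + 1 + l) (f (du - 1 - l)) := by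
  obtain rfl : dv = j + 1 + du := by omega
  have h : ∑ i ∈ range du, e (j + 1 + i) (f (j + 1 + du - 1 - (j + 1 + i))) =
      e (j + 1 + l) (f (du - 1 - l)) := by
    rw [sum_eq_single l]
    · congr 2
      omega
    · intro i hi hne
      have := mem_range.1 hi
      rw [hf _ (by omega) (by omega), map_zero]
    · intro h
      exact absurd (mem_range.2 hl) h
  rw [sum_range_add, sum_range_succ, h, show j + 1 + du - 1 - j = du by omega]

/-- If the operators of `v` arise from those of `w` by multiplying the characteristic polynomial
by a linear factor on the left, solutions for `w` are solutions for `v`. -/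
theorem solSpace_le_of_factor {e e' : ℕ → Module.End k M} {d : ℕ} (hd : e d = 0)
    (h : ∀ l < d, e' (l + 1) = e (l + 1) - (e' 0 - e 0) * e l) :
    solSpace e d ≤ solSpace e' (d + 1) := by
  intro f hf m
  have h1 := hf (m + 1)
  have h0 := hf m
  rw [show m + (d + 1) = m + 1 + d by omega, h1, sum_range_succ']
  have hsum : ∑ i ∈ range d, e' (i + 1) (f (m + 1 + d - 1 - (i + 1))) =
      ∑ i ∈ range d, e (i + 1) (f (m + 1 + d - 1 - (i + 1))) - (e' 0 - e 0) (f (m + d)) := by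
    rw [h0, map_sum, ← sum_sub_distrib]
    refine sum_congr rfl fun i hi => ?_
    have := mem_range.1 hi
    rw [h i this, show m + 1 + d - 1 - (i + 1) = m + d - 1 - i by omega]
    rfl
  have hs := sum_range_succ' (fun i => e i (f (m + 1 + d - 1 - i))) d
  rw [sum_range_succ, hd] at hs
  simp only [LinearMap.zero_apply, add_zero] at hs
  rw [hsum, hs, show m + 1 + d - 1 - 0 = m + d by omega, LinearMap.sub_apply]
  abel

end Recurrence

section Model

/-- A letter `(A, j)` stands for the `S`-monomial `S_A^j`. -/
abbrev Letter (n : ℕ) := Finset (Fin n) × ℕ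

/-- The normal words. -/
abbrev NWord (n : ℕ) := {l : List (Letter n) // IsNormalWord n l}

/-- The free module on the normal words. -/
abbrev NMod (k : Type) [Field k] (n : ℕ) := NWord n →₀ k

/-- A pair of consecutive letters forbidden in normal words. -/
def Redex {n : ℕ} (p q : Letter n) : Prop :=
  q.1 ⊂ p.1 ∧ q.1.card + p.2 + 1 = p.1.card

/-- The letters encoding genuine `S`-monomials. -/
def ValidLetter {n : ℕ} (p : Letter n) : Prop :=
  p.1.Nonempty ∧ p.2 + 1 ≤ p.1.card

variable {n : ℕ}

theorem isNormalWord_nil : IsNormalWord n [] :=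
  ⟨by simp, List.isChain_nil⟩

theorem not_redex_iff {p q : Letter n} (hp : ValidLetter p) (hq : ValidLetter q) :
    ¬ Redex p q ↔ (¬ q.1 ⊆ p.1 ∨ q.1.card ≠ p.1.card - p.2 - 1) := by
  have h1 := hp.2
  have h2 := hq.2
  rw [← not_iff_not, not_not, not_or, not_not, not_not, Redex, ssubset_iff_subset_ne]
  constructor
  · rintro ⟨⟨h, -⟩, h'⟩
    exact ⟨h, by omega⟩
  · rintro ⟨h, h'⟩
    refine ⟨⟨h, ?_⟩, by omega⟩
    intro he
    rw [he] at h'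
    omega

theorem isNormalWord_cons_cons {p q : Letter n} {l : List (Letter n)} :
    IsNormalWord n (p :: q :: l) ↔
      ValidLetter p ∧ IsNormalWord n (q :: l) ∧ ¬ Redex p q := by
  constructor
  · rintro ⟨h1, h2⟩
    have hp : ValidLetter p := h1 p (by simp)
    have hq : ValidLetter q := h1 q (by simp)
    have h2' := List.isChain_cons_cons.1 h2
    exact ⟨hp, ⟨fun x hx => h1 x (List.mem_cons_of_mem _ hx), h2'.2⟩,
      (not_redex_iff hp hq).2 h2'.1⟩
  · rintro ⟨hp, ⟨h1, h2⟩, h3⟩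
    have hq : ValidLetter q := h1 q (by simp)
    refine ⟨?_, List.isChain_cons_cons.2 ⟨(not_redex_iff hp hq).1 h3, h2⟩⟩
    intro x hx
    rcases List.mem_cons.1 hx with rfl | hx
    · exact hp
    · exact h1 x hx

theorem IsNormalWord.of_cons {p : Letter n} {l : List (Letter n)}
    (h : IsNormalWord n (p :: l)) : IsNormalWord n l := by
  cases l with
  | nil => exact isNormalWord_nil
  | cons q l => exact (isNormalWord_cons_cons.1 h).2.1

theorem IsNormalWord.validLetter {p : Letter n} {l : List (Letter n)}
    (h : IsNormalWord n (p :: l)) : ValidLetter p :=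
  h.1 p (by simp)

variable (k : Type) [Field k]

/-- The basis vector of a normal word, and zero for all other words. -/
def mkWord (l : List (Letter n)) : NMod k n :=
  open Classical in if h : IsNormalWord n l then Finsupp.single ⟨l, h⟩ 1 else 0

variable {k}

theorem mkWord_of_normal {l : List (Letter n)} (h : IsNormalWord n l) :
    mkWord k l = Finsupp.single ⟨l, h⟩ 1 :=
  dif_pos h

theorem mkWord_of_not_normal {l : List (Letter n)} (h : ¬ IsNormalWord n l) :
    mkWord k l = 0 :=
  dif_neg h

variable (k) in
/-- Prepending a letter to normal words, with non-normal results replaced by zero. -/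
def prepend (p : Letter n) : Module.End k (NMod k n) :=
  Finsupp.linearCombination k fun z : NWord n => mkWord k (p :: z.1)

theorem prepend_mkWord (p : Letter n) {l : List (Letter n)} (h : IsNormalWord n l) :
    prepend k p (mkWord k l) = mkWord k (p :: l) := by
  rw [mkWord_of_normal h, prepend, Finsupp.linearCombination_single, one_smul]

/-- The action of the letter `(v, j)` on words, given the action of smaller letters. -/
def actWord (v : Finset (Fin n))
    (prev : (u : Finset (Fin n)) → u ⊂ v → ℕ → Module.End k (NMod k n)) :
    List (Letter n) → ℕ → NMod k n
  | [], j => mkWord k [(v, j)]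
  | q :: z, j =>
    open Classical in
    if h : Redex (v, j) q then
      fund (prev q.1 h.1) q.1.card q.2 (mkWord k z) v.card
        - ∑ i ∈ range j, prepend k (v, i)
            (fund (prev q.1 h.1) q.1.card q.2 (mkWord k z) (v.card - 1 - i))
        - actWord v prev z (j + 1 + q.2)
    else mkWord k ((v, j) :: q :: z)

variable (k) in
/-- The action of the letters on the free module on the normal words. -/
def act (v : Finset (Fin n)) : ℕ → Module.End k (NMod k n) := fun j =>
  Finsupp.linearCombination k fun z : NWord n => actWord v (fun u _ => act u) z.1 j
termination_by v.card
decreasing_by exact card_lt_card ‹_›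

theorem act_mkWord (v : Finset (Fin n)) (j : ℕ) {l : List (Letter n)} (h : IsNormalWord n l) :
    act k v j (mkWord k l) = actWord v (fun u _ => act k u) l j := by
  rw [mkWord_of_normal h, act, Finsupp.linearCombination_single, one_smul]

theorem act_nil (v : Finset (Fin n)) (j : ℕ) : act k v j (mkWord k []) = mkWord k [(v, j)] := by
  rw [act_mkWord v j isNormalWord_nil, actWord]

theorem act_cons_of_not_redex {v : Finset (Fin n)} {j : ℕ} {q : Letter n} {z : List (Letter n)}
    (h : IsNormalWord n (q :: z)) (hr : ¬ Redex (v, j) q) :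
    act k v j (mkWord k (q :: z)) = mkWord k ((v, j) :: q :: z) := by
  rw [act_mkWord v j h, actWord, dif_neg hr]

theorem act_cons_of_redex {v : Finset (Fin n)} {j : ℕ} {q : Letter n} {z : List (Letter n)}
    (h : IsNormalWord n (q :: z)) (hr : Redex (v, j) q) :
    act k v j (mkWord k (q :: z)) =
      fund (act k q.1) q.1.card q.2 (mkWord k z) v.card
        - ∑ i ∈ range j, prepend k (v, i)
            (fund (act k q.1) q.1.card q.2 (mkWord k z) (v.card - 1 - i))
        - act k v (j + 1 + q.2) (mkWord k z) := by
  rw [act_mkWord v j h, actWord, dif_pos hr, act_mkWord v _ h.of_cons]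

theorem act_of_normal {v : Finset (Fin n)} {j : ℕ} {z : List (Letter n)}
    (h : IsNormalWord n ((v, j) :: z)) : act k v j (mkWord k z) = mkWord k ((v, j) :: z) := by
  cases z with
  | nil => exact act_nil v j
  | cons q z =>
    have h' := isNormalWord_cons_cons.1 h
    exact act_cons_of_not_redex h'.2.1 h'.2.2

theorem linearMap_ext_mkWord {P : Type*} [AddCommMonoid P] [Module k P] {S T : NMod k n →ₗ[k] P}
    (h : ∀ z, IsNormalWord n z → S (mkWord k z) = T (mkWord k z)) : S = T := by
  refine Finsupp.lhom_ext' fun z => LinearMap.ext_ring ?_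
  simpa [mkWord_of_normal z.2] using h z.1 z.2

theorem act_eq_zero (v : Finset (Fin n)) {j : ℕ} (hj : v.card ≤ j) : act k v j = 0 := by
  have hv : ∀ z, ¬ IsNormalWord n ((v, j) :: z) := by
    intro z hz
    have := hz.validLetter.2
    simp only at this
    omega
  refine linearMap_ext_mkWord fun z hz => ?_
  rw [LinearMap.zero_apply]
  cases z with
  | nil => rw [act_nil, mkWord_of_not_normal (hv _)]
  | cons q z =>
    rw [act_cons_of_not_redex hz, mkWord_of_not_normal (hv _)]
    rintro ⟨-, h⟩
    simp only at h
    omega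

variable (k) in
/-- The span of the normal words whose first letter is supported in `u`. -/
def below (u : Finset (Fin n)) : Submodule k (NMod k n) :=
  Submodule.span k {x | ∃ q z, IsNormalWord n (q :: z) ∧ q.1 ⊆ u ∧ x = mkWord k (q :: z)}

theorem below_mono {u v : Finset (Fin n)} (h : u ⊆ v) : below k u ≤ below k v := by
  refine Submodule.span_mono ?_
  rintro x ⟨q, z, hz, hq, rfl⟩
  exact ⟨q, z, hz, hq.trans h, rfl⟩

theorem mkWord_mem_below (q : Letter n) (z : List (Letter n)) :
    mkWord k (q :: z) ∈ below k q.1 := by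
  by_cases h : IsNormalWord n (q :: z)
  · exact Submodule.subset_span ⟨q, z, h, Subset.rfl, rfl⟩
  · rw [mkWord_of_not_normal h]
    exact zero_mem _

theorem map_mem_of_forall_mkWord {P : Type*} [AddCommMonoid P] [Module k P]
    (T : NMod k n →ₗ[k] P) (p : Submodule k P)
    (h : ∀ z, IsNormalWord n z → T (mkWord k z) ∈ p) (x : NMod k n) : T x ∈ p := by
  induction x using Finsupp.induction_linear with
  | zero => simp
  | add x y hx hy => rw [map_add]; exact p.add_mem hx hy
  | single z c =>
    have := h z.1 z.2
    rw [mkWord_of_normal z.2] at this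
    rw [← mul_one c, ← smul_eq_mul, ← Finsupp.smul_single, map_smul]
    exact p.smul_mem c this

theorem prepend_mem_below (p : Letter n) (x : NMod k n) : prepend k p x ∈ below k p.1 := by
  refine map_mem_of_forall_mkWord _ _ (fun z hz => ?_) x
  rw [prepend_mkWord p hz]
  exact mkWord_mem_below p z

theorem fund_mem_below_of {u : Finset (Fin n)} (hu : ∀ i x, act k u i x ∈ below k u) (l : ℕ)
    (x : NMod k n) {m : ℕ} (hm : u.card ≤ m) : fund (act k u) u.card l x m ∈ below k u := by
  obtain ⟨c, rfl⟩ := Nat.exists_eq_add_of_le' hm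
  rw [fund_mem (act k u) u.card l x c]
  exact Submodule.sum_mem _ fun i _ => hu _ _

theorem act_mem_below (v : Finset (Fin n)) (j : ℕ) (x : NMod k n) : act k v j x ∈ below k v := by
  induction v using Finset.strongInduction generalizing j x with
  | H v ih =>
    refine map_mem_of_forall_mkWord _ _ (fun z hz => ?_) x
    induction z generalizing j with
    | nil =>
      rw [act_nil]
      exact mkWord_mem_below (v, j) []
    | cons q z ihz =>
      by_cases hr : Redex (v, j) q
      · rw [act_cons_of_redex hz hr]
        refine Submodule.sub_mem _ (Submodule.sub_mem _ ?_ (Submodule.sum_mem _ fun i _ => ?_))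
          (ihz _ hz.of_cons)
        · exact below_mono hr.1.subset
            (fund_mem_below_of (fun i x => ih _ hr.1 i x) _ _ (card_le_card hr.1.subset))
        · exact prepend_mem_below (v, i) _
      · rw [act_cons_of_not_redex hz hr]
        exact mkWord_mem_below (v, j) _

theorem fund_mem_below (u : Finset (Fin n)) (l : ℕ) (x : NMod k n) {m : ℕ} (hm : u.card ≤ m) :
    fund (act k u) u.card l x m ∈ below k u :=
  fund_mem_below_of (act_mem_below u) l x hm

theorem isNormalWord_cons_of_subset {p q : Letter n} {u : Finset (Fin n)} {z : List (Letter n)}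
    (hq : q.1 ⊆ u) (hz : IsNormalWord n (q :: z)) (hp : u.card + p.2 + 1 < p.1.card) :
    IsNormalWord n (p :: q :: z) := by
  refine isNormalWord_cons_cons.2 ⟨⟨card_pos.1 (by omega), by omega⟩, hz, ?_⟩
  rintro ⟨-, h⟩
  have := card_le_card hq
  omega

theorem eq_on_below {P : Type*} [AddCommMonoid P] [Module k P] {S T : NMod k n →ₗ[k] P}
    {u : Finset (Fin n)} {x : NMod k n} (hx : x ∈ below k u)
    (h : ∀ q z, IsNormalWord n (q :: z) → q.1 ⊆ u → S (mkWord k (q :: z)) = T (mkWord k (q :: z))) :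
    S x = T x := by
  refine LinearMap.eqOn_span ?_ hx
  rintro x ⟨q, z, hz, hq, rfl⟩
  exact h q z hz hq

theorem prepend_eq_act_of_mem_below {u v : Finset (Fin n)} {i : ℕ} {x : NMod k n}
    (hx : x ∈ below k u) (h : u.card + i + 1 < v.card) : prepend k (v, i) x = act k v i x := by
  refine eq_on_below hx fun q z hz hq => ?_
  rw [prepend_mkWord _ hz, act_of_normal (isNormalWord_cons_of_subset hq hz h)]

end Model

section CharOp

variable {k : Type*} [CommRing k] {M : Type*} [AddCommGroup M] [Module k M]

/-- The defect of the recurrence of order `d` at position `d`. -/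
def charOp (e : ℕ → Module.End k M) (d : ℕ) : (ℕ → M) →ₗ[k] M :=
  LinearMap.proj (φ := fun _ => M) d
    - ∑ i ∈ range d, e i ∘ₗ LinearMap.proj (φ := fun _ => M) (d - 1 - i)

theorem charOp_apply (e : ℕ → Module.End k M) (d : ℕ) (f : ℕ → M) :
    charOp e d f = f d - ∑ i ∈ range d, e i (f (d - 1 - i)) := by
  simp [charOp]

theorem mem_solSpace_of_charOp {e : ℕ → Module.End k M} {d : ℕ} {f : ℕ → M}
    (h : ∀ m, charOp e d (fun i => f (m + i)) = 0) : f ∈ solSpace e d := by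
  intro m
  have := h m
  rw [charOp_apply, sub_eq_zero] at this
  refine this.trans (sum_congr rfl fun i hi => ?_)
  have := mem_range.1 hi
  congr 2
  omega

theorem charOp_eq_zero_of_fund {e e' : ℕ → Module.End k M} {d d' : ℕ} {f : ℕ → M}
    (hf : f ∈ solSpace e d)
    (h : ∀ l < d, charOp e' d' (fund e d l (f (d - 1 - l))) = 0) : charOp e' d' f = 0 := by
  rw [eq_sum_fund hf, map_sum]
  exact sum_eq_zero fun l hl => h l (mem_range.1 hl)

end CharOp

section Inclusion

variable {k : Type} [Field k] {n : ℕ}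

theorem charOp_fund_of_normal {u v : Finset (Fin n)} {l : ℕ} {z : List (Letter n)} (huv : u ⊂ v)
    (h : IsNormalWord n ((u, l) :: z)) :
    charOp (act k v) v.card (fund (act k u) u.card l (mkWord k z)) = 0 := by
  have hc := card_lt_card huv
  have hl : l < u.card := h.validLetter.2
  obtain ⟨j, hj⟩ : ∃ j, u.card + j + 1 = v.card := ⟨v.card - u.card - 1, by omega⟩
  have hr : Redex (v, j) (u, l) := ⟨huv, hj⟩
  rw [charOp_apply, sum_range_eq_of_init (act k v) hj hl
    (fun m hm hne => fund_of_lt_of_ne _ _ _ hm hne), fund_self _ _ hl, act_of_normal h,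
    act_cons_of_redex h hr, fund_init _ _ hl]
  have hs : ∀ i ∈ range j,
      prepend k (v, i) (fund (act k u) u.card l (mkWord k z) (v.card - 1 - i)) =
        act k v i (fund (act k u) u.card l (mkWord k z) (v.card - 1 - i)) := by
    intro i hi
    have := mem_range.1 hi
    exact prepend_eq_act_of_mem_below (fund_mem_below u l _ (by omega)) (by omega)
  rw [sum_congr rfl hs]
  abel

theorem charOp_fund_of_mem_below {u v w : Finset (Fin n)} {l : ℕ} {x : NMod k n} (huv : u ⊂ v)
    (hx : x ∈ below k w) (hw : w.card + l + 1 < u.card) :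
    charOp (act k v) v.card (fund (act k u) u.card l x) = 0 := by
  refine eq_on_below (S := charOp (act k v) v.card ∘ₗ fund (act k u) u.card l) (T := 0) hx
    fun q z hz hq => ?_
  exact charOp_fund_of_normal huv (isNormalWord_cons_of_subset hq hz hw)

theorem charOp_fund_mkWord {v : Finset (Fin n)}
    (ih : ∀ u ⊂ v, ∀ w ⊂ u, solSpace (act k w) w.card ≤ solSpace (act k u) u.card)
    {z : List (Letter n)} (hz : IsNormalWord n z) {u : Finset (Fin n)} (huv : u ⊂ v) {l : ℕ}
    (hl : l < u.card) : charOp (act k v) v.card (fund (act k u) u.card l (mkWord k z)) = 0 := by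
  induction z generalizing u l with
  | nil =>
    refine charOp_fund_of_normal huv ⟨?_, List.isChain_singleton _⟩
    intro p hp
    rw [List.mem_singleton.1 hp]
    exact ⟨card_pos.1 (Nat.zero_lt_of_lt hl), hl⟩
  | cons q z ihz =>
    by_cases h : IsNormalWord n ((u, l) :: q :: z)
    · exact charOp_fund_of_normal huv h
    obtain ⟨w, b⟩ := q
    have hr : Redex (u, l) (w, b) := by
      by_contra hr
      exact h (isNormalWord_cons_cons.2 ⟨⟨card_pos.1 (Nat.zero_lt_of_lt hl), hl⟩, hz, hr⟩)
    have hwu : w ⊂ u := hr.1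
    have hcard : w.card + l + 1 = u.card := hr.2
    have hb : b < w.card := hz.validLetter.2
    set g := fund (act k w) w.card b (mkWord k z) with hg
    have hg0 : charOp (act k v) v.card g = 0 := charOp_fund_of_normal (hwu.trans huv) hz
    have hgu : g ∈ solSpace (act k u) u.card := ih u huv w hwu (fund_mem _ _ _ _)
    set f := fund (act k u) u.card l (mkWord k ((w, b) :: z)) with hf
    have hfg : charOp (act k v) v.card (f - g) = 0 := by
      refine charOp_eq_zero_of_fund (Submodule.sub_mem _ (fund_mem _ _ _ _) hgu) fun l' hl' => ?_
      rw [Pi.sub_apply]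
      rcases lt_trichotomy (u.card - 1 - l') w.card with hlt | heq | hgt
      · rw [hf, hg, fund_of_lt_of_ne _ _ _ (by omega) (by omega), zero_sub, map_neg, map_neg,
          neg_eq_zero, fund_of_lt _ _ _ hlt]
        split_ifs
        · exact ihz hz.of_cons huv hl'
        · rw [map_zero, map_zero]
      · rw [heq, hg, fund_self _ _ hb, act_of_normal hz, hf, fund_of_lt _ _ _ (by omega),
          if_pos (by omega), sub_self, map_zero, map_zero]
      · rw [hf, fund_of_lt_of_ne _ _ _ (by omega) (by omega), zero_sub, map_neg, map_neg,
          neg_eq_zero]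
        exact charOp_fund_of_mem_below huv (fund_mem_below w b _ hgt.le) (by omega)
    rwa [map_sub, hg0, sub_zero] at hfg

theorem solSpace_act_le {u v : Finset (Fin n)} (huv : u ⊂ v) :
    solSpace (act k u) u.card ≤ solSpace (act k v) v.card := by
  induction v using Finset.strongInduction generalizing u with
  | H v ih =>
    intro f hf
    refine mem_solSpace_of_charOp fun m => charOp_eq_zero_of_fund (solSpace_shift hf m) ?_
    intro l hl
    exact map_mem_of_forall_mkWord (charOp (act k v) v.card ∘ₗ fund (act k u) u.card l) ⊥
      (fun z hz => charOp_fund_mkWord (fun u hu w hw => ih u hu hw) hz huv hl) _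

theorem act_factor {v w : Finset (Fin n)} (hwv : w ⊂ v) (hc : w.card + 1 = v.card) (l : ℕ) :
    act k v (l + 1) = act k w (l + 1) - (act k v 0 - act k w 0) * act k w l := by
  rcases lt_or_ge l w.card with hl | hl
  swap
  · rw [act_eq_zero v (by omega), act_eq_zero w hl, act_eq_zero w (by omega), mul_zero]
    exact (sub_zero (0 : Module.End k (NMod k n))).symm
  refine LinearMap.ext fun x => ?_
  have hf := fund_mem (act k w) w.card l x
  have hinit : ∀ m < w.card, m ≠ w.card - 1 - l → fund (act k w) w.card l x m = 0 :=
    fun m hm hne => fund_of_lt_of_ne _ _ _ hm hne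
  have hv := solSpace_act_le hwv hf 0
  rw [zero_add, sum_range_eq_of_init (act k v) (j := 0) (by omega) hl hinit, range_zero, sum_empty,
    zero_add, fund_init _ _ hl, fund_self _ _ hl] at hv
  have hw := hf 1
  have hs := sum_range_succ
    (fun i => act k w i (fund (act k w) w.card l x (w.card + 1 - 1 - i))) w.card
  rw [act_eq_zero w le_rfl, LinearMap.zero_apply, add_zero,
    sum_range_eq_of_init (act k w) (j := 0) (by omega) hl hinit, range_zero, sum_empty,
    zero_add, fund_init _ _ hl, fund_self _ _ hl] at hs
  rw [add_comm 1, ← hs, hc, hv] at hw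
  simp only [zero_add, add_comm 1 l] at hw
  simp only [LinearMap.sub_apply, Module.End.mul_apply]
  rw [← eq_sub_iff_add_eq'] at hw
  rw [hw]
  abel

end Inclusion

section RingIdentities

variable {R : Type*} [Ring R]

theorem quadratic_relation_eq (a b c d : R) :
    a * (b - c) + (b - c) * d - b ^ 2 + c ^ 2 = (a - b) * (b - d) - (a - c) * (c - d) := by
  simp only [mul_sub, sub_mul, pow_two]
  abel

theorem double_factor_zero (a b d x : R) :
    x - (b - d) * d - (a - b) * b = x - (a - d) * d - (a - b) * (b - d) := by
  simp only [mul_sub, sub_mul]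
  abel

theorem quadratic_relation_eq_zero {a b c d x : R}
    (h : x - (b - d) * d - (a - b) * b = x - (c - d) * d - (a - c) * c) :
    a * (b - c) + (b - c) * d - b ^ 2 + c ^ 2 = 0 := by
  rw [double_factor_zero, double_factor_zero, sub_right_inj] at h
  rw [quadratic_relation_eq, h, sub_self]

theorem double_factor (a b d x y z : R) :
    x - (b - d) * y - (a - b) * (y - (b - d) * z) =
      x - (a - d) * y + (a - b) * (b - d) * z := by
  simp only [mul_sub, sub_mul, mul_assoc]
  abel

end RingIdentities

section Representation

variable (k : Type) [Field k] {n : ℕ}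

/-- The action of the free algebra on the span of the normal words. -/
def freeAct (n : ℕ) : FreeA k n →ₐ[k] Module.End k (NMod k n) :=
  FreeAlgebra.lift k fun A : SubsetIdx n => act k A.1 0

theorem freeAct_rGen (A : Finset (Fin n)) : freeAct k n (rGen k n A) = act k A 0 := by
  by_cases h : A.Nonempty
  · rw [rGen, dif_pos h, freeAct, FreeAlgebra.lift_ι_apply]
  · rw [rGen, dif_neg h, map_zero, act_eq_zero A]
    rw [not_nonempty_iff_eq_empty.1 h, card_empty]

theorem act_factor_erase {A : Finset (Fin n)} {i : Fin n} (hi : i ∈ A) (l : ℕ) :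
    act k A (l + 1) =
      act k (A.erase i) (l + 1) - (act k A 0 - act k (A.erase i) 0) * act k (A.erase i) l :=
  act_factor (erase_ssubset hi) (card_erase_add_one hi) l

theorem freeAct_fRel {A : Finset (Fin n)} {i j : Fin n} (hi : i ∈ A) (hj : j ∈ A) :
    freeAct k n (fRel k n A i j) = 0 := by
  simp only [fRel, map_add, map_sub, map_mul, map_pow, freeAct_rGen]
  rcases eq_or_ne i j with rfl | hij
  · simp
  have h1 := act_factor_erase k hi 0
  have h2 := act_factor_erase k hj 0
  rw [act_factor_erase k (mem_erase.2 ⟨hij.symm, hj⟩) 0] at h1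
  rw [act_factor_erase k (mem_erase.2 ⟨hij, hi⟩) 0, erase_right_comm, h1] at h2
  exact quadratic_relation_eq_zero (R := Module.End k (NMod k n)) h2

/-- The action of `Q_n` on the span of the normal words. -/
def QnAct (n : ℕ) : Qn k n →ₐ[k] Module.End k (NMod k n) :=
  RingQuot.liftAlgHom k ⟨freeAct k n, by
    rintro _ _ ⟨A, i, j, hi, hj⟩
    rw [freeAct_fRel k hi hj, map_zero]⟩

theorem QnAct_QnMk (x : FreeA k n) : QnAct k n (QnMk k n x) = freeAct k n x :=
  RingQuot.liftAlgHom_mkAlgHom_apply _ _ _ _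

/-- The image of `r_A` in `Q_n`. -/
def rQ (A : Finset (Fin n)) : Qn k n := QnMk k n (rGen k n A)

theorem QnAct_rQ (A : Finset (Fin n)) : QnAct k n (rQ k A) = act k A 0 := by
  rw [rQ, QnAct_QnMk, freeAct_rGen]

theorem rQ_empty : rQ k (∅ : Finset (Fin n)) = 0 := by
  rw [rQ, rGen, dif_neg Finset.not_nonempty_empty, map_zero]

theorem rQ_rel {A : Finset (Fin n)} {i j : Fin n} (hi : i ∈ A) (hj : j ∈ A) :
    (rQ k A - rQ k (A.erase i)) * (rQ k (A.erase i) - rQ k ((A.erase i).erase j)) =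
      (rQ k A - rQ k (A.erase j)) * (rQ k (A.erase j) - rQ k ((A.erase i).erase j)) := by
  have h : QnMk k n (fRel k n A i j) = QnMk k n 0 :=
    RingQuot.mkAlgHom_rel k (QnRel.rel A i j hi hj)
  rw [fRel, quadratic_relation_eq, map_zero] at h
  simp only [map_sub, map_mul] at h
  exact sub_eq_zero.1 h

theorem eraseMin_of_nonempty {A : Finset (Fin n)} (h : A.Nonempty) :
    eraseMin A = A.erase (A.min' h) :=
  dif_pos h

theorem eraseMin_ssubset {A : Finset (Fin n)} (h : A.Nonempty) : eraseMin A ⊂ A := by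
  rw [eraseMin_of_nonempty h]
  exact erase_ssubset (A.min'_mem h)

theorem card_eraseMin_add_one {A : Finset (Fin n)} (h : A.Nonempty) :
    (eraseMin A).card + 1 = A.card := by
  rw [eraseMin_of_nonempty h]
  exact card_erase_add_one (A.min'_mem h)

/-- The coefficients, up to sign, of the monic polynomial with coefficients in `Q_n` attached
to `A`, whose subleading coefficient is `-r_A`. -/
def coeffQ (A : Finset (Fin n)) : ℕ → Qn k n
  | 0 => rQ k A
  | t + 1 =>
    if _ : A.Nonempty then
      coeffQ (eraseMin A) (t + 1) - (rQ k A - rQ k (eraseMin A)) * coeffQ (eraseMin A) t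
    else 0
termination_by A.card
decreasing_by all_goals exact card_lt_card (eraseMin_ssubset ‹_›)

theorem coeffQ_zero (A : Finset (Fin n)) : coeffQ k A 0 = rQ k A := by
  rw [coeffQ]

theorem coeffQ_factor {A : Finset (Fin n)} {i : Fin n} (hi : i ∈ A) (t : ℕ) :
    coeffQ k A (t + 1) =
      coeffQ k (A.erase i) (t + 1) - (rQ k A - rQ k (A.erase i)) * coeffQ k (A.erase i) t := by
  induction A using Finset.strongInduction generalizing i t with
  | H A ih =>
    have hA : A.Nonempty := ⟨i, hi⟩
    have hm := A.min'_mem hA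
    rw [coeffQ, dif_pos hA, eraseMin_of_nonempty hA]
    rcases eq_or_ne i (A.min' hA) with him | him
    · rw [← him]
    have hrel := rQ_rel k hi hm
    have h1 := fun s => ih _ (erase_ssubset hi) (mem_erase.2 ⟨him.symm, hm⟩) s
    have h2 := fun s => ih _ (erase_ssubset hm) (mem_erase.2 ⟨him, hi⟩) s
    simp only [erase_right_comm (a := A.min' hA) (b := i)] at h2
    rw [h1 t, h2 t]
    cases t with
    | zero =>
      simp only [coeffQ_zero]
      rw [double_factor_zero, double_factor_zero, hrel]
    | succ t =>
      rw [h1 t, h2 t, double_factor, double_factor, hrel]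

theorem coeffQ_eq_zero {A : Finset (Fin n)} {t : ℕ} (h : A.card ≤ t) : coeffQ k A t = 0 := by
  induction A using Finset.strongInduction generalizing t with
  | H A ih =>
    cases t with
    | zero => rw [coeffQ_zero, card_eq_zero.1 (Nat.le_zero.1 h), rQ_empty]
    | succ t =>
      rw [coeffQ]
      split_ifs with hA
      · have := card_eraseMin_add_one hA
        rw [ih _ (eraseMin_ssubset hA) (by omega), ih _ (eraseMin_ssubset hA) (by omega), mul_zero,
          sub_zero]
      · rfl

/-- Left multiplication by `coeffQ`. -/
def mulCoeffQ (A : Finset (Fin n)) (t : ℕ) : Module.End k (Qn k n) :=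
  LinearMap.mulLeft k (coeffQ k A t)

theorem mulCoeffQ_apply (A : Finset (Fin n)) (t : ℕ) (x : Qn k n) :
    mulCoeffQ k A t x = coeffQ k A t * x :=
  rfl

theorem solSpace_mulCoeffQ_le {u v : Finset (Fin n)} (huv : u ⊆ v) :
    solSpace (mulCoeffQ k u) u.card ≤ solSpace (mulCoeffQ k v) v.card := by
  induction v using Finset.strongInduction with
  | H v ih =>
    rcases eq_or_ssubset_of_subset huv with rfl | h
    · exact le_rfl
    obtain ⟨i, hiv, hiu⟩ := exists_of_ssubset h
    refine (ih _ (erase_ssubset hiv) (subset_erase.2 ⟨huv, hiu⟩)).trans ?_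
    rw [← card_erase_add_one hiv]
    refine solSpace_le_of_factor ?_ fun l _ => ?_
    · refine LinearMap.ext fun x => ?_
      rw [mulCoeffQ_apply, coeffQ_eq_zero k le_rfl, zero_mul, LinearMap.zero_apply]
    · refine LinearMap.ext fun x => ?_
      simp only [LinearMap.sub_apply, Module.End.mul_apply, mulCoeffQ_apply,
        coeffQ_factor k hiv l, coeffQ_zero, sub_mul, mul_assoc]

/-- The linear map sending a normal word to the product of the corresponding coefficients. -/
def wordQ (n : ℕ) : NMod k n →ₗ[k] Qn k n :=
  Finsupp.linearCombination k fun z : NWord n => (z.1.map fun p => coeffQ k p.1 p.2).prod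

theorem wordQ_mkWord {z : List (Letter n)} (h : IsNormalWord n z) :
    wordQ k n (mkWord k z) = (z.map fun p => coeffQ k p.1 p.2).prod := by
  rw [mkWord_of_normal h, wordQ, Finsupp.linearCombination_single, one_smul]

theorem wordQ_mkWord_cons {p : Letter n} {z : List (Letter n)} (h : IsNormalWord n (p :: z)) :
    wordQ k n (mkWord k (p :: z)) = coeffQ k p.1 p.2 * wordQ k n (mkWord k z) := by
  rw [wordQ_mkWord k h, wordQ_mkWord k h.of_cons, List.map_cons, List.prod_cons]

theorem wordQ_act (v : Finset (Fin n)) (j : ℕ) (x : NMod k n) :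
    wordQ k n (act k v j x) = coeffQ k v j * wordQ k n x := by
  induction v using Finset.strongInduction generalizing j x with
  | H v ih =>
    rw [← mulCoeffQ_apply, ← LinearMap.comp_apply, ← LinearMap.comp_apply]
    refine LinearMap.congr_fun (linearMap_ext_mkWord fun z hz => ?_) x
    rw [LinearMap.comp_apply, LinearMap.comp_apply, mulCoeffQ_apply]
    induction z generalizing j with
    | nil =>
      rcases lt_or_ge j v.card with hj | hj
      · have h : IsNormalWord n [(v, j)] := by
          refine ⟨?_, List.isChain_singleton _⟩
          intro p hp
          rw [List.mem_singleton.1 hp]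
          exact ⟨card_pos.1 (Nat.zero_lt_of_lt hj), hj⟩
        rw [act_nil, wordQ_mkWord_cons k h]
      · rw [act_eq_zero v hj, coeffQ_eq_zero k hj, LinearMap.zero_apply, map_zero, zero_mul]
    | cons q z ihz =>
      rcases lt_or_ge j v.card with hj | hj
      swap
      · rw [act_eq_zero v hj, coeffQ_eq_zero k hj, LinearMap.zero_apply, map_zero, zero_mul]
      by_cases hr : Redex (v, j) q
      swap
      · rw [act_cons_of_not_redex hz hr, wordQ_mkWord_cons]
        exact isNormalWord_cons_cons.2 ⟨⟨card_pos.1 (Nat.zero_lt_of_lt hj), hj⟩, hz, hr⟩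
      obtain ⟨u, l⟩ := q
      have huv : u ⊂ v := hr.1
      have hc : u.card + j + 1 = v.card := hr.2
      have hl : l < u.card := hz.validLetter.2
      rw [act_cons_of_redex hz hr, map_sub, map_sub, map_sum, ihz _ hz.of_cons,
        wordQ_mkWord_cons k hz]
      set f := fund (act k u) u.card l (mkWord k z) with hf
      have hg : (fun m => wordQ k n (f m)) ∈ solSpace (mulCoeffQ k v) v.card :=
        solSpace_mulCoeffQ_le k huv.subset
          (solSpace_map (wordQ k n) (fun i y => ih u huv i y) (fund_mem _ _ _ _))
      have hp : ∀ i ∈ range j, wordQ k n (prepend k (v, i) (f (v.card - 1 - i))) =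
          mulCoeffQ k v i (wordQ k n (f (v.card - 1 - i))) := by
        intro i hi
        have := mem_range.1 hi
        refine eq_on_below (S := wordQ k n ∘ₗ prepend k (v, i))
          (T := mulCoeffQ k v i ∘ₗ wordQ k n) (fund_mem_below u l _ (by omega)) fun q y hy hq => ?_
        rw [LinearMap.comp_apply, LinearMap.comp_apply, prepend_mkWord _ hy, wordQ_mkWord_cons,
          mulCoeffQ_apply]
        exact isNormalWord_cons_of_subset hq hy (by simp only; omega)
      have h0 := hg 0
      have hinit : ∀ m < u.card, m ≠ u.card - 1 - l → (fun m => wordQ k n (f m)) m = 0 := by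
        intro m hm hne
        simp only [hf, fund_of_lt_of_ne _ _ _ hm hne, map_zero]
      rw [zero_add, sum_range_eq_of_init (mulCoeffQ k v) hc hl hinit] at h0
      simp only at h0
      rw [sum_congr rfl hp, h0, hf, fund_self _ _ hl, fund_init _ _ hl, act_of_normal hz,
        wordQ_mkWord_cons k hz]
      simp only [mulCoeffQ_apply]
      abel

/-- The linear map `a ↦ a · 1` from `Q_n` to the span of the normal words. -/
def evalNil (n : ℕ) : Qn k n →ₗ[k] NMod k n :=
  LinearMap.applyₗ (mkWord k []) ∘ₗ (QnAct k n).toLinearMap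

theorem evalNil_apply (x : Qn k n) : evalNil k n x = QnAct k n x (mkWord k []) :=
  rfl

theorem wordQ_QnAct (x : Qn k n) (y : NMod k n) : wordQ k n (QnAct k n x y) = x * wordQ k n y := by
  obtain ⟨a, rfl⟩ : ∃ a, QnMk k n a = x := RingQuot.mkAlgHom_surjective k _ x
  induction a using FreeAlgebra.induction generalizing y with
  | grade0 c => simp [Algebra.smul_def]
  | grade1 A =>
    have h : FreeAlgebra.ι k A = rGen k n A.1 := by rw [rGen, dif_pos A.2]
    rw [h, ← rQ, QnAct_rQ, wordQ_act, coeffQ_zero]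
  | mul a b ha hb => rw [map_mul, map_mul, Module.End.mul_apply, ha, hb, mul_assoc]
  | add a b ha hb => rw [map_add, map_add, LinearMap.add_apply, map_add, ha, hb, add_mul]

theorem evalNil_injective : Function.Injective (evalNil k n) := by
  refine Function.LeftInverse.injective (g := wordQ k n) fun x => ?_
  rw [evalNil_apply, wordQ_QnAct, wordQ_mkWord k isNormalWord_nil, List.map_nil, List.prod_nil,
    mul_one]

end Representation

section Filtration

variable {k : Type} [Field k] {n : ℕ}

/-- The degree of a letter: the sum of the sizes of the index sets of the generators whose
product is the corresponding `S`-monomial. -/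
def wtLetter (p : Letter n) : ℕ := ∑ i ∈ range (p.2 + 1), (p.1.card - i)

theorem wtLetter_zero (v : Finset (Fin n)) : wtLetter (v, 0) = v.card := by
  simp [wtLetter]

theorem wtLetter_succ (v : Finset (Fin n)) (j : ℕ) :
    wtLetter (v, j + 1) = wtLetter (v, j) + (v.card - (j + 1)) :=
  sum_range_succ _ _

theorem wtLetter_add_le (v : Finset (Fin n)) (i j : ℕ) :
    wtLetter (v, i + j) ≤ wtLetter (v, i) + j * v.card := by
  induction j with
  | zero => simp
  | succ j ih =>
    rw [← add_assoc, wtLetter_succ, add_mul, one_mul]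
    omega

theorem wtLetter_le (v : Finset (Fin n)) (i : ℕ) : wtLetter (v, i) ≤ (i + 1) * v.card := by
  have h := wtLetter_add_le v 0 i
  rw [zero_add, wtLetter_zero] at h
  rw [add_mul, one_mul]
  omega

theorem wtLetter_add_mul_le {u v : Finset (Fin n)} {i j : ℕ} (h : u.card + i + j < v.card) :
    wtLetter (v, i) + j * u.card ≤ wtLetter (v, i + j) := by
  induction j with
  | zero => simp
  | succ j ih =>
    have := ih (by omega)
    rw [← add_assoc, wtLetter_succ, add_mul, one_mul]
    omega

theorem wtLetter_add_of_card {u v : Finset (Fin n)} {j : ℕ} (h : u.card + j + 1 = v.card) (l : ℕ) :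
    wtLetter (v, j + 1 + l) = wtLetter (v, j) + wtLetter (u, l) := by
  rw [wtLetter, add_assoc (j + 1), sum_range_add]
  refine congrArg₂ _ rfl (sum_congr rfl fun i _ => ?_)
  simp only
  omega

/-- The degree of a word. -/
def wtWord (z : List (Letter n)) : ℕ := (z.map wtLetter).sum

theorem wtWord_cons (p : Letter n) (z : List (Letter n)) :
    wtWord (p :: z) = wtLetter p + wtWord z := by
  rw [wtWord, List.map_cons, List.sum_cons, wtWord]

variable (k n) in
/-- The span of the normal words of degree less than `m`. -/
def filt (m : ℕ) : Submodule k (NMod k n) :=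
  Finsupp.supported k k {z : NWord n | wtWord z.1 < m}

theorem filt_mono {m m' : ℕ} (h : m ≤ m') : filt k n m ≤ filt k n m' :=
  Finsupp.supported_mono fun _ hz => lt_of_lt_of_le hz h

theorem mkWord_mem_filt {z : List (Letter n)} {m : ℕ} (h : wtWord z < m) :
    mkWord k z ∈ filt k n m := by
  by_cases hz : IsNormalWord n z
  · rw [mkWord_of_normal hz]
    exact Finsupp.single_mem_supported _ _ h
  · rw [mkWord_of_not_normal hz]
    exact Submodule.zero_mem _

theorem map_mem_filt {T : Module.End k (NMod k n)} {c : ℕ}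
    (h : ∀ z, IsNormalWord n z → T (mkWord k z) ∈ filt k n (wtWord z + c + 1)) {m : ℕ}
    {y : NMod k n} (hy : y ∈ filt k n m) : T y ∈ filt k n (m + c) := by
  rw [filt, Finsupp.supported_eq_span_single] at hy
  refine Submodule.span_induction (p := fun y _ => T y ∈ filt k n (m + c)) ?_ ?_ ?_ ?_ hy
  · rintro _ ⟨z, hz, rfl⟩
    have hz' : wtWord z.1 < m := hz
    have h' := h z.1 z.2
    rw [mkWord_of_normal z.2] at h'
    exact filt_mono (by omega) h'
  · rw [map_zero]
    exact Submodule.zero_mem _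
  · intro x y _ _ hx hy
    rw [map_add]
    exact Submodule.add_mem _ hx hy
  · intro a x _ hx
    rw [map_smul]
    exact Submodule.smul_mem _ _ hx

theorem prepend_mem_filt (p : Letter n) {m : ℕ} {y : NMod k n} (hy : y ∈ filt k n m) :
    prepend k p y ∈ filt k n (m + wtLetter p) := by
  refine map_mem_filt (fun z hz => ?_) hy
  rw [prepend_mkWord p hz]
  refine mkWord_mem_filt ?_
  rw [wtWord_cons]
  omega

theorem fund_mem_filt {u : Finset (Fin n)}
    (hu : ∀ (i m : ℕ) (y : NMod k n), y ∈ filt k n m → act k u i y ∈ filt k n (m + wtLetter (u, i)))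
    {l : ℕ} (hl : l < u.card) (m : ℕ) {c : ℕ} {x : NMod k n} (hx : x ∈ filt k n c) :
    fund (act k u) u.card l x (u.card + m) ∈ filt k n (c + wtLetter (u, l) + m * u.card) := by
  induction m using Nat.strong_induction_on with
  | _ m ih =>
    rw [add_comm u.card m, fund_mem (act k u) u.card l x m]
    refine Submodule.sum_mem _ fun i hi => ?_
    have hiu := mem_range.1 hi
    rcases lt_or_ge i m with him | him
    · obtain ⟨s, rfl⟩ := Nat.exists_eq_add_of_lt him
      have hs : i + s + 1 + u.card - 1 - i = u.card + s := by omega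
      rw [hs]
      refine filt_mono ?_ (hu i _ _ (ih s (by omega)))
      have := wtLetter_le u i
      rw [show i + s + 1 = s + (i + 1) by ring, add_mul s]
      omega
    · by_cases hil : i = l + m
      · rw [show m + u.card - 1 - i = u.card - 1 - l by omega, fund_init _ _ (by omega)]
        refine filt_mono ?_ (hu i _ _ hx)
        have := wtLetter_add_le u l m
        rw [hil]
        omega
      · rw [fund_of_lt_of_ne _ _ _ (by omega) (by omega), map_zero]
        exact Submodule.zero_mem _

theorem act_mem_filt (v : Finset (Fin n)) (j m : ℕ) {y : NMod k n} (hy : y ∈ filt k n m) :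
    act k v j y ∈ filt k n (m + wtLetter (v, j)) := by
  induction v using Finset.strongInduction generalizing j m y with
  | H v ih =>
    refine map_mem_filt (fun z hz => ?_) hy
    clear hy
    have hcons (j : ℕ) (z : List (Letter n)) : mkWord k ((v, j) :: z) ∈ filt k n (wtWord z + wtLetter (v, j) + 1) := by
      refine mkWord_mem_filt ?_
      rw [wtWord_cons]
      omega
    induction z generalizing j with
    | nil =>
      rw [act_nil]
      exact hcons j []
    | cons q z ihz =>
      by_cases hr : Redex (v, j) q
      swap
      · rw [act_cons_of_not_redex hz hr]
        exact hcons j (q :: z)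
      obtain ⟨u, l⟩ := q
      have huv : u ⊂ v := hr.1
      have hc : u.card + j + 1 = v.card := hr.2
      have hf : ∀ s, fund (act k u) u.card l (mkWord k z) (u.card + s) ∈
          filt k n (wtWord z + 1 + wtLetter (u, l) + s * u.card) := fun s =>
        fund_mem_filt (fun i m y hy => ih u huv i m hy) hz.validLetter.2 s (mkWord_mem_filt (Nat.lt_succ_self _))
      rw [act_cons_of_redex hz hr, wtWord_cons]
      refine Submodule.sub_mem _ (Submodule.sub_mem _ ?_ (Submodule.sum_mem _ fun i hi => ?_)) ?_
      · have h0 := hf (j + 1)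
        rw [← add_assoc, hc] at h0
        refine filt_mono ?_ h0
        have h1 := wtLetter_add_mul_le (u := u) (v := v) (i := 0) (j := j) (by omega)
        rw [zero_add, wtLetter_zero] at h1
        rw [add_mul, one_mul]
        omega
      · obtain ⟨s, rfl⟩ := Nat.exists_eq_add_of_lt (mem_range.1 hi)
        have hs : v.card - 1 - i = u.card + (s + 1) := by omega
        have h1 := wtLetter_add_mul_le (u := u) (v := v) (i := i) (j := s + 1) (by omega)
        rw [← add_assoc] at h1
        simp only [hs]
        refine filt_mono ?_ (prepend_mem_filt _ (hf _))
        omega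
      · refine filt_mono ?_ (ihz (j + 1 + l) hz.of_cons)
        have := wtLetter_add_of_card hc l
        omega

theorem freeAct_SMon_sub_mem_filt {A : Finset (Fin n)} {t : ℕ} (ht : t < A.card) {m : ℕ}
    {y : NMod k n} (hy : y ∈ filt k n (m + 1)) :
    freeAct k n (SMon k n t A) y - (-1 : k) ^ t • act k A t y ∈
      filt k n (m + wtLetter (A, t)) := by
  induction t generalizing A with
  | zero =>
    rw [SMon, freeAct_rGen, pow_zero, one_smul, sub_self]
    exact Submodule.zero_mem _
  | succ t ih =>
    have hA : A.Nonempty := card_pos.1 (by omega)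
    have hc := card_eraseMin_add_one hA
    have hr := ih (A := eraseMin A) (by omega)
    set r := freeAct k n (SMon k n t (eraseMin A)) y - (-1 : k) ^ t • act k (eraseMin A) t y
      with hrdef
    have hS : freeAct k n (SMon k n t (eraseMin A)) y =
        (-1 : k) ^ t • act k (eraseMin A) t y + r := by
      rw [hrdef]
      abel
    have hfac := LinearMap.congr_fun (act_factor (k := k) (eraseMin_ssubset hA) hc t) y
    simp only [LinearMap.sub_apply, Module.End.mul_apply] at hfac
    have key : freeAct k n (SMon k n (t + 1) A) y - (-1 : k) ^ (t + 1) • act k A (t + 1) y =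
        (-1 : k) ^ t • (act k (eraseMin A) 0 (act k (eraseMin A) t y) +
          act k (eraseMin A) (t + 1) y) + act k A 0 r := by
      rw [SMon, map_mul, freeAct_rGen, Module.End.mul_apply, hS, map_add, map_smul, hfac, pow_succ,
        mul_neg_one, neg_smul, ← sub_eq_zero]
      simp only [smul_sub, smul_add]
      abel
    have hw := wtLetter_add_of_card (j := 0) hc t
    rw [zero_add, add_comm 1 t, wtLetter_zero] at hw
    have hw' := wtLetter_succ (eraseMin A) t
    rw [key]
    refine Submodule.add_mem _ (Submodule.smul_mem _ _ (Submodule.add_mem _ ?_ ?_)) ?_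
    · refine filt_mono ?_ (act_mem_filt _ 0 _ (act_mem_filt _ t _ hy))
      rw [wtLetter_zero]
      omega
    · refine filt_mono ?_ (act_mem_filt _ (t + 1) _ hy)
      omega
    · refine filt_mono ?_ (act_mem_filt _ 0 _ hr)
      rw [wtLetter_zero]
      omega

theorem exists_freeAct_wordVal_sub_mem_filt {z : List (Letter n)} (hz : IsNormalWord n z) :
    ∃ s : ℕ, freeAct k n (wordVal k n z) (mkWord k []) - (-1 : k) ^ s • mkWord k z ∈
      filt k n (wtWord z) := by
  induction z with
  | nil =>
    refine ⟨0, ?_⟩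
    rw [wordVal, List.map_nil, List.prod_nil, map_one, Module.End.one_apply, pow_zero, one_smul,
      sub_self]
    exact Submodule.zero_mem _
  | cons p z ih =>
    obtain ⟨A, t⟩ := p
    obtain ⟨s, hs⟩ := ih hz.of_cons
    refine ⟨s + t, ?_⟩
    set y := freeAct k n (wordVal k n z) (mkWord k [])
    have hy : y ∈ filt k n (wtWord z + 1) := by
      rw [← sub_add_cancel y ((-1 : k) ^ s • mkWord k z)]
      exact Submodule.add_mem _ (filt_mono (Nat.le_succ _) hs)
        (Submodule.smul_mem _ _ (mkWord_mem_filt (Nat.lt_succ_self _)))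
    have h1 := freeAct_SMon_sub_mem_filt (A := A) hz.validLetter.2 hy
    have h2 := Submodule.smul_mem _ ((-1 : k) ^ t) (act_mem_filt A t _ hs)
    rw [wordVal, List.map_cons, List.prod_cons, ← wordVal, map_mul, Module.End.mul_apply,
      wtWord_cons, add_comm (wtLetter _)]
    convert Submodule.add_mem _ h1 h2 using 1
    rw [map_sub, map_smul, act_of_normal hz, smul_sub, smul_smul, ← pow_add, add_comm t s]
    abel

end Filtration

section Triangular

variable {K ι : Type*} [Field K] {wt : ι → ℕ} {b : ι → ι →₀ K} {ε : ι → K}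

theorem linearIndependent_of_triangular (hε : ∀ i, ε i ≠ 0)
    (hb : ∀ i, b i - Finsupp.single i (ε i) ∈ Finsupp.supported K K {j | wt j < wt i}) :
    LinearIndependent K b := by
  have hlt : ∀ i j, ¬ wt j < wt i → b i j = Finsupp.single i (ε i) j := by
    intro i j hij
    rw [← sub_eq_zero, ← Finsupp.sub_apply]
    exact Finsupp.notMem_support_iff.1 fun h => hij ((Finsupp.mem_supported K _).1 (hb i) h)
  rw [linearIndependent_iff]
  intro c hc
  by_contra hne
  obtain ⟨i, hi, hmax⟩ := exists_max_image c.support wt (Finsupp.support_nonempty_iff.2 hne)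
  have h := DFunLike.congr_fun hc i
  rw [Finsupp.linearCombination_apply, Finsupp.sum, Finsupp.finsetSum_apply,
    sum_eq_single_of_mem i hi] at h
  · rw [Finsupp.smul_apply, hlt i i (lt_irrefl _), Finsupp.single_eq_same, smul_eq_mul,
      Finsupp.zero_apply] at h
    exact mul_ne_zero (Finsupp.mem_support_iff.1 hi) (hε i) h
  · intro j hj hji
    rw [Finsupp.smul_apply, hlt j i (hmax j hj).not_gt, Finsupp.single_eq_of_ne hji.symm, smul_zero]

theorem span_eq_top_of_triangular (hε : ∀ i, ε i ≠ 0)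
    (hb : ∀ i, b i - Finsupp.single i (ε i) ∈ Finsupp.supported K K {j | wt j < wt i}) :
    Submodule.span K (Set.range b) = ⊤ := by
  have hs : ∀ m i, wt i < m → Finsupp.single i 1 ∈ Submodule.span K (Set.range b) := by
    intro m
    induction m with
    | zero => exact fun i hi => absurd hi (Nat.not_lt_zero _)
    | succ m ih =>
      intro i hi
      have hr : b i - Finsupp.single i (ε i) ∈ Submodule.span K (Set.range b) := by
        have h := hb i
        rw [Finsupp.supported_eq_span_single] at h
        refine Submodule.span_le.2 ?_ h
        rintro _ ⟨j, hj, rfl⟩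
        have hj' : wt j < wt i := hj
        exact ih j (by omega)
      have h := Submodule.smul_mem _ (ε i)⁻¹
        (Submodule.sub_mem _ (Submodule.subset_span (Set.mem_range_self i)) hr)
      rwa [sub_sub_cancel, Finsupp.smul_single, smul_eq_mul, inv_mul_cancel₀ (hε i)] at h
  refine eq_top_iff.2 ?_
  rw [← Finsupp.span_single_eq_top, Submodule.span_le]
  rintro _ ⟨i, a, rfl⟩
  have h := Submodule.smul_mem _ a (hs _ i (Nat.lt_succ_self _))
  rwa [Finsupp.smul_single, smul_eq_mul, mul_one] at h

end Triangular

theorem normal_monomials_basis_Qn (k : Type) [Field k] (n : ℕ) (hn : 2 ≤ n) :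
    LinearIndependent k
      (fun l : {l : List (Finset (Fin n) × ℕ) // IsNormalWord n l} =>
        QnMk k n (wordVal k n l.1)) ∧
    Submodule.span k
      (Set.range (fun l : {l : List (Finset (Fin n) × ℕ) // IsNormalWord n l} =>
        QnMk k n (wordVal k n l.1))) = ⊤ := by
  have h : ∀ z : NWord n, ∃ s : ℕ, evalNil k n (QnMk k n (wordVal k n z.1)) -
      Finsupp.single z ((-1 : k) ^ s) ∈ filt k n (wtWord z.1) := by
    intro z
    obtain ⟨s, hs⟩ := exists_freeAct_wordVal_sub_mem_filt (k := k) z.2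
    rw [mkWord_of_normal z.2, Finsupp.smul_single, smul_eq_mul, mul_one] at hs
    exact ⟨s, by rwa [evalNil_apply, QnAct_QnMk]⟩
  choose s hs using h
  have hε : ∀ z, (-1 : k) ^ s z ≠ 0 := fun z => pow_ne_zero _ (neg_ne_zero.2 one_ne_zero)
  refine ⟨LinearIndependent.of_comp (evalNil k n) (linearIndependent_of_triangular hε hs),
    Submodule.map_injective_of_injective (evalNil_injective k)
      (le_antisymm (Submodule.map_mono le_top) (le_top.trans ?_))⟩
  rw [Submodule.map_span, ← Set.range_comp]
  exact (span_eq_top_of_triangular hε hs).ge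
end
end

section
/- For every field k and every integer n ≥ 2, and for all nonempty subsets C ≠ C' of I_n, the right ideals r_C·gn and r_{C'}·gn of gn have zero intersection: (r_C·gn) ∩ (r_{C'}·gn) = 0. -/
/-!
STATEMENT 6: For every field `k` and every integer `n ≥ 2`, and for all nonempty subsets
`C ≠ C'` of `I_n`, the right ideals `r_C·gn` and `r_{C'}·gn` of `gn` have zero
intersection: `(r_C·gn) ∩ (r_{C'}·gn) = {0}`.
-/

noncomputable section

open Finset

/-- The quadratic relation `h_{A;i,j} = r_A (r_{A∖i} - r_{A∖j})`. -/
def hRel (k : Type) [Field k] (n : ℕ) (A : Finset (Fin n)) (i j : Fin n) : FreeA k n :=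
  rGen k n A * (rGen k n (A.erase i) - rGen k n (A.erase j))

/-- The relation identifying each `h_{A;i,j}` (for `i, j ∈ A`) with `0`. -/
inductive GnRel (k : Type) [Field k] (n : ℕ) : FreeA k n → FreeA k n → Prop
  | rel (A : Finset (Fin n)) (i j : Fin n) (hi : i ∈ A) (hj : j ∈ A) :
      GnRel k n (hRel k n A i j) 0

/-- The algebra `gn = F/I`. -/
abbrev Gn (k : Type) [Field k] (n : ℕ) := RingQuot (GnRel k n)

/-- The quotient map `F → gn`. -/
def GnMk (k : Type) [Field k] (n : ℕ) : FreeA k n →ₐ[k] Gn k n :=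
  RingQuot.mkAlgHom k (GnRel k n)

/-- The right ideal `r_C·gn`, i.e. the set of all elements `r_C·a`, `a ∈ gn`. -/
def rightIdealOf (k : Type) [Field k] (n : ℕ) (C : Finset (Fin n)) : Set (Gn k n) :=
  {x | ∃ a : Gn k n, x = GnMk k n (rGen k n C) * a}

/-- The image of `r_A` in the representation of `gn` by `2 × 2` matrices over `gn` whose lower
left entry singles out the words with first letter `r_C`. -/
def firstLetterMatrix (k : Type) [Field k] (n : ℕ) (C A : Finset (Fin n)) :
    Matrix (Fin 2) (Fin 2) (Gn k n) :=
  !![GnMk k n (rGen k n A), 0; if A = C then GnMk k n (rGen k n A) else 0, 0]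

/-- The representation of the free algebra sending `r_A` to `firstLetterMatrix k n C A`. -/
def freeFirstLetter (k : Type) [Field k] (n : ℕ) (C : Finset (Fin n)) :
    FreeA k n →ₐ[k] Matrix (Fin 2) (Fin 2) (Gn k n) :=
  FreeAlgebra.lift k fun A : SubsetIdx n => firstLetterMatrix k n C A

theorem freeFirstLetter_rGen (k : Type) [Field k] (n : ℕ) (C A : Finset (Fin n)) :
    freeFirstLetter k n C (rGen k n A) = firstLetterMatrix k n C A := by
  by_cases h : A.Nonempty
  · simp [freeFirstLetter, rGen, h]
  · ext i j
    fin_cases i <;> fin_cases j <;> simp [firstLetterMatrix, rGen, h]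

theorem GnMk_hRel (k : Type) [Field k] (n : ℕ) {A : Finset (Fin n)} {i j : Fin n}
    (hi : i ∈ A) (hj : j ∈ A) : GnMk k n (hRel k n A i j) = 0 := by
  simpa [GnMk] using RingQuot.mkAlgHom_rel k (GnRel.rel (k := k) A i j hi hj)

theorem freeFirstLetter_eq_of_rel (k : Type) [Field k] (n : ℕ) (C : Finset (Fin n))
    ⦃x y : FreeA k n⦄ (h : GnRel k n x y) : freeFirstLetter k n C x = freeFirstLetter k n C y := by
  obtain ⟨A, i, j, hi, hj⟩ := h
  have h0 := GnMk_hRel k n hi hj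
  rw [hRel, map_mul, map_sub] at h0
  rw [hRel, map_mul, map_sub, map_zero, freeFirstLetter_rGen, freeFirstLetter_rGen,
    freeFirstLetter_rGen]
  ext a b
  fin_cases a <;> fin_cases b <;>
    simp [firstLetterMatrix, Matrix.mul_apply, Fin.sum_univ_two, h0]

/-- The representation of `gn` induced by `freeFirstLetter`. -/
def firstLetter (k : Type) [Field k] (n : ℕ) (C : Finset (Fin n)) :
    Gn k n →ₐ[k] Matrix (Fin 2) (Fin 2) (Gn k n) :=
  RingQuot.liftAlgHom k ⟨freeFirstLetter k n C, freeFirstLetter_eq_of_rel k n C⟩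

theorem firstLetter_GnMk (k : Type) [Field k] (n : ℕ) (C : Finset (Fin n)) (x : FreeA k n) :
    firstLetter k n C (GnMk k n x) = freeFirstLetter k n C x :=
  RingQuot.liftAlgHom_mkAlgHom_apply ..

theorem freeFirstLetter_top_row (k : Type) [Field k] (n : ℕ) (C : Finset (Fin n))
    (x : FreeA k n) :
    freeFirstLetter k n C x 0 0 = GnMk k n x ∧ freeFirstLetter k n C x 0 1 = 0 := by
  induction x using FreeAlgebra.induction with
  | grade0 r => simp [Matrix.algebraMap_matrix_apply]
  | grade1 A => simp [freeFirstLetter, firstLetterMatrix, rGen, A.2]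
  | mul a b ha hb => simp [Matrix.mul_apply, Fin.sum_univ_two, ha, hb]
  | add a b ha hb => simp [ha, hb]

theorem firstLetter_rGen_mul (k : Type) [Field k] (n : ℕ) (C A : Finset (Fin n)) (a : Gn k n) :
    firstLetter k n C (GnMk k n (rGen k n A) * a) 1 0 =
      if A = C then GnMk k n (rGen k n A) * a else 0 := by
  obtain ⟨x, rfl⟩ : ∃ x, GnMk k n x = a := RingQuot.mkAlgHom_surjective k (GnRel k n) a
  rw [map_mul, firstLetter_GnMk, firstLetter_GnMk, freeFirstLetter_rGen]
  simp [firstLetterMatrix, Matrix.mul_apply, Fin.sum_univ_two, freeFirstLetter_top_row]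

theorem rightIdeals_intersect_trivially (k : Type) [Field k] (n : ℕ) (hn : 2 ≤ n)
    (C C' : Finset (Fin n)) (hC : C.Nonempty) (hC' : C'.Nonempty) (hne : C ≠ C') :
    rightIdealOf k n C ∩ rightIdealOf k n C' = {0} := by
  refine Set.Subset.antisymm ?_ ?_
  · rintro x ⟨⟨a, ha⟩, ⟨b, hb⟩⟩
    have h₁ := firstLetter_rGen_mul k n C C a
    have h₂ := firstLetter_rGen_mul k n C C' b
    rw [← ha, if_pos rfl] at h₁
    rw [← hb, if_neg hne.symm] at h₂
    exact h₁.symm.trans h₂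
  · rintro x rfl
    exact ⟨⟨0, (mul_zero _).symm⟩, ⟨0, (mul_zero _).symm⟩⟩
end
end

section
/- Let A ⊆ I_n be nonempty with minimal element a_1, let t ≥ 1, and let B ⊆ A with |B| = t+1 and a_1 ∉ B. Pick b ∈ B and set B' = B∖{b} and A' = A∖{a_1}. Then in the free algebra F one has the identity g^t_{A,B} = r_A · g^{t−1}_{A',B'} + g^{t−1}_{A,B'} · ( r_{A'∖B'} − r_{A∖B} ) + S^{t−1}_A · h_{A∖B'; b, a_1}. -/
/-!
STATEMENT 9: Let `A ⊆ I_n` be nonempty with minimal element `a_1`, let `t ≥ 1`, and let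
`B ⊆ A` with `|B| = t+1` and `a_1 ∉ B`. Pick `b ∈ B` and set `B' = B∖{b}` and
`A' = A∖{a_1}`. Then in the free algebra `F` one has the identity
`g^t_{A,B} = r_A · g^{t−1}_{A',B'} + g^{t−1}_{A,B'} · (r_{A'∖B'} − r_{A∖B})
  + S^{t−1}_A · h_{A∖B'; b, a_1}`.
-/

noncomputable section

open Finset

/-- The element `g^t_{A,B} = S_A^t · r_{A∖B} − S_A^{t+1}` of the free algebra. -/
def gElt (k : Type) [Field k] (n : ℕ) (t : ℕ) (A B : Finset (Fin n)) : FreeA k n :=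
  SMon k n t A * rGen k n (A \ B) - SMon k n (t+1) A

theorem gElt_recurrence (k : Type) [Field k] (n : ℕ) (hn : 2 ≤ n)
    (A : Finset (Fin n)) (hA : A.Nonempty) (t : ℕ) (ht : 1 ≤ t) (B : Finset (Fin n))
    (hBA : B ⊆ A) (hBcard : B.card = t + 1) (hmin : A.min' hA ∉ B)
    (b : Fin n) (hb : b ∈ B) :
    gElt k n t A B =
      rGen k n A * gElt k n (t - 1) (A.erase (A.min' hA)) (B.erase b)
      + gElt k n (t - 1) A (B.erase b) *
          (rGen k n ((A.erase (A.min' hA)) \ (B.erase b)) - rGen k n (A \ B))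
      + SMon k n (t - 1) A * hRel k n (A \ (B.erase b)) b (A.min' hA) := by
  obtain ⟨s, rfl⟩ : ∃ s, t = s + 1 := ⟨t - 1, by omega⟩
  have hb_sdiff : (A \ B.erase b).erase b = A \ B := by
    ext x
    by_cases hx : x = b
    · simp [hx, hb]
    · simp [hx]
  have hmin_sdiff :
      (A \ B.erase b).erase (A.min' hA) = A.erase (A.min' hA) \ B.erase b := by
    rw [Finset.erase_sdiff_comm]
  have hS (m : ℕ) :
      SMon k n (m + 1) A = rGen k n A * SMon k n m (A.erase (A.min' hA)) := by
    simp only [SMon, eraseMin, dif_pos hA]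
  simp only [gElt, hRel, Nat.add_sub_cancel, hb_sdiff, hmin_sdiff, hS]
  noncomm_ring
end
end

section
/- Let A ⊆ I_n be nonempty, let t ≥ 0 with t ≤ |A| − 1, and let B_1, …, B_t be subsets of A with |B_i| = i for every i. Then in gn = F/I the image of the monomial r_A · r_{A∖B_1} · r_{A∖B_2} ⋯ r_{A∖B_t} equals the image of S^t_A. -/
/-!
STATEMENT 11: Let `A ⊆ I_n` be nonempty, let `t ≥ 0` with `t ≤ |A| − 1`, and let
`B_1, …, B_t` be subsets of `A` with `|B_i| = i` for every `i`. Then in `gn = F/I` the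
image of the monomial `r_A · r_{A∖B_1} · r_{A∖B_2} ⋯ r_{A∖B_t}` equals the image of
`S^t_A`.
-/

noncomputable section

open Finset

/-- A function on `m`-subsets of `A` that is invariant under exchanging one element is constant. -/
theorem eq_of_exchange_invariant {α β : Type*} [DecidableEq α] {A : Finset α} {m : ℕ}
    {f : Finset α → β}
    (hf : ∀ D x y, D ⊆ A → D.card = m → x ∈ A → y ∈ A → x ∉ D → y ∉ D →
      f (insert x D) = f (insert y D))
    {B B' : Finset α} (hB : B ⊆ A) (hB' : B' ⊆ A) (hc : B.card = m + 1) (hc' : B'.card = m + 1) :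
    f B = f B' := by
  induction hd : (B \ B').card generalizing B with
  | zero =>
    rw [Finset.card_eq_zero, Finset.sdiff_eq_empty_iff_subset] at hd
    rw [Finset.eq_of_subset_of_card_le hd (by lia)]
  | succ d ih =>
    obtain ⟨x, hx⟩ : (B \ B').Nonempty := Finset.card_pos.mp (by lia)
    obtain ⟨y, hy⟩ : (B' \ B).Nonempty := by
      rw [← Finset.card_pos, Finset.card_sdiff_comm (hc'.trans hc.symm)]
      lia
    rw [Finset.mem_sdiff] at hx hy
    have hsd : insert y (B.erase x) \ B' = (B \ B').erase x := by
      rw [Finset.insert_sdiff_of_mem _ hy.1, Finset.erase_sdiff_comm]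
    have hy_erase : y ∉ B.erase x := fun h => hy.2 (Finset.mem_of_mem_erase h)
    have hcard : (B.erase x).card = m := by
      rw [Finset.card_erase_of_mem hx.1]
      lia
    have hsub : B.erase x ⊆ A := (Finset.erase_subset x B).trans hB
    calc f B = f (insert x (B.erase x)) := by rw [Finset.insert_erase hx.1]
      _ = f (insert y (B.erase x)) :=
        hf _ x y hsub hcard (hB hx.1) (hB' hy.1) (Finset.notMem_erase x B) hy_erase
      _ = f B' := by
        refine ih (Finset.insert_subset (hB' hy.1) hsub) ?_ ?_
        · rw [Finset.card_insert_of_notMem hy_erase, hcard]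
        · rw [hsd, Finset.card_erase_of_mem (Finset.mem_sdiff.mpr hx)]
          lia

theorem eraseMin_subset {n : ℕ} (A : Finset (Fin n)) : eraseMin A ⊆ A := by
  unfold eraseMin
  split_ifs
  · exact Finset.erase_subset _ _
  · exact Finset.empty_subset _

theorem card_eraseMin {n : ℕ} (A : Finset (Fin n)) : (eraseMin A).card = A.card - 1 := by
  unfold eraseMin
  split_ifs with h
  · exact Finset.card_erase_of_mem (A.min'_mem h)
  · simp [Finset.not_nonempty_iff_eq_empty.mp h]

theorem iterate_eraseMin_subset {n : ℕ} (t : ℕ) (A : Finset (Fin n)) : eraseMin^[t] A ⊆ A := by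
  induction t with
  | zero => exact Finset.Subset.refl A
  | succ t ih =>
    rw [Function.iterate_succ_apply']
    exact (eraseMin_subset _).trans ih

theorem card_iterate_eraseMin {n : ℕ} (t : ℕ) (A : Finset (Fin n)) :
    (eraseMin^[t] A).card = A.card - t := by
  induction t with
  | zero => rfl
  | succ t ih =>
    rw [Function.iterate_succ_apply', card_eraseMin, ih]
    lia

theorem SMon_succ_eq_mul_rGen (k : Type) [Field k] (n t : ℕ) (A : Finset (Fin n)) :
    SMon k n (t + 1) A = SMon k n t A * rGen k n (eraseMin^[t + 1] A) := by
  induction t generalizing A with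
  | zero => rfl
  | succ t ih =>
    rw [SMon, ih, ← mul_assoc, ← Function.iterate_succ_apply]
    rfl

theorem GnMk_rGen_mul_rGen_erase (k : Type) [Field k] (n : ℕ) {A : Finset (Fin n)} {i j : Fin n}
    (hi : i ∈ A) (hj : j ∈ A) :
    GnMk k n (rGen k n A) * GnMk k n (rGen k n (A.erase i)) =
      GnMk k n (rGen k n A) * GnMk k n (rGen k n (A.erase j)) := by
  have h : GnMk k n (hRel k n A i j) = GnMk k n 0 :=
    RingQuot.mkAlgHom_rel k (GnRel.rel A i j hi hj)
  rwa [hRel, map_mul, map_sub, map_zero, mul_sub, sub_eq_zero] at h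

/-- If `S_A^t` can be made to end in `r_{A∖D}` for every `t`-subset `D` of `A`, then
`S_A^t · r_{A∖B}` does not depend on the `(t+1)`-subset `B` of `A`. -/
theorem GnMk_SMon_mul_rGen_sdiff_eq {k : Type} [Field k] {n t : ℕ} {A : Finset (Fin n)}
    (h : ∀ D ⊆ A, D.card = t → ∃ X, GnMk k n (SMon k n t A) = X * GnMk k n (rGen k n (A \ D)))
    {B B' : Finset (Fin n)} (hB : B ⊆ A) (hB' : B' ⊆ A)
    (hc : B.card = t + 1) (hc' : B'.card = t + 1) :
    GnMk k n (SMon k n t A) * GnMk k n (rGen k n (A \ B)) =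
      GnMk k n (SMon k n t A) * GnMk k n (rGen k n (A \ B')) := by
  refine eq_of_exchange_invariant
    (f := fun B => GnMk k n (SMon k n t A) * GnMk k n (rGen k n (A \ B)))
    (fun D x y hD hDc hx hy hxD hyD => ?_) hB hB' hc hc'
  obtain ⟨X, hX⟩ := h D hD hDc
  simp only [hX, mul_assoc, Finset.sdiff_insert]
  rw [GnMk_rGen_mul_rGen_erase k n (Finset.mem_sdiff.mpr ⟨hx, hxD⟩)
    (Finset.mem_sdiff.mpr ⟨hy, hyD⟩)]

theorem GnMk_SMon_succ_of_exists_right_factor {k : Type} [Field k] {n t : ℕ}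
    {A : Finset (Fin n)} (ht : t + 1 ≤ A.card)
    (h : ∀ D ⊆ A, D.card = t → ∃ X, GnMk k n (SMon k n t A) = X * GnMk k n (rGen k n (A \ D)))
    {B : Finset (Fin n)} (hB : B ⊆ A) (hc : B.card = t + 1) :
    GnMk k n (SMon k n (t + 1) A) =
      GnMk k n (SMon k n t A) * GnMk k n (rGen k n (A \ B)) := by
  have hsub := iterate_eraseMin_subset (t + 1) A
  rw [SMon_succ_eq_mul_rGen, map_mul, ← Finset.sdiff_sdiff_eq_self hsub]
  refine GnMk_SMon_mul_rGen_sdiff_eq h Finset.sdiff_subset hB ?_ hc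
  rw [Finset.card_sdiff_of_subset hsub, card_iterate_eraseMin]
  lia

theorem exists_GnMk_SMon_eq_mul_rGen_sdiff (k : Type) [Field k] (n : ℕ) {t : ℕ}
    {A : Finset (Fin n)} (ht : t ≤ A.card) :
    ∀ D ⊆ A, D.card = t →
      ∃ X, GnMk k n (SMon k n t A) = X * GnMk k n (rGen k n (A \ D)) := by
  induction t with
  | zero =>
    intro D _ hD
    rw [Finset.card_eq_zero] at hD
    exact ⟨1, by rw [hD, Finset.sdiff_empty, one_mul, SMon]⟩
  | succ t ih =>
    intro D hD hc
    exact ⟨_, GnMk_SMon_succ_of_exists_right_factor ht (ih (by lia)) hD hc⟩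

theorem GnMk_SMon_succ (k : Type) [Field k] (n : ℕ) {t : ℕ} {A B : Finset (Fin n)}
    (hB : B ⊆ A) (hc : B.card = t + 1) :
    GnMk k n (SMon k n (t + 1) A) =
      GnMk k n (SMon k n t A) * GnMk k n (rGen k n (A \ B)) := by
  have ht : t + 1 ≤ A.card := hc ▸ Finset.card_le_card hB
  exact GnMk_SMon_succ_of_exists_right_factor ht
    (exists_GnMk_SMon_eq_mul_rGen_sdiff k n (by lia)) hB hc

theorem monomial_reduces_to_SMon (k : Type) [Field k] (n : ℕ) (hn : 2 ≤ n)
    (A : Finset (Fin n)) (hA : A.Nonempty) (t : ℕ) (ht : t ≤ A.card - 1)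
    (B : Fin t → Finset (Fin n)) (hBA : ∀ i, B i ⊆ A)
    (hBcard : ∀ i, (B i).card = (i : ℕ) + 1) :
    GnMk k n (rGen k n A * (List.ofFn (fun i => rGen k n (A \ B i))).prod) =
      GnMk k n (SMon k n t A) := by
  induction t with
  | zero => simp [SMon]
  | succ t ih =>
    rw [GnMk_SMon_succ k n (t := t) (hBA (Fin.last t)) (hBcard (Fin.last t)),
      ← ih (by lia) (fun i => B i.castSucc) (fun i => hBA _) (fun i => hBcard _),
      List.ofFn_succ', List.concat_eq_append, List.prod_append, List.prod_singleton,
      ← mul_assoc, map_mul]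
end
end

section
/- For every field k and integers 2 ≤ m ≤ n, the k-algebra homomorphism φ: gm → gn determined by sending the generator r_A (for each nonempty A ⊆ I_m) to the generator r_A of gn is well defined and injective, and its image is the unital subalgebra P_m of gn generated by {r_A : ∅ ≠ A ⊆ I_m}. -/
/-!
STATEMENT 12: For every field `k` and integers `2 ≤ m ≤ n`, the `k`-algebra homomorphism
`φ : gm → gn` determined by sending the generator `r_A` (for each nonempty `A ⊆ I_m`) to
the generator `r_A` of `gn` is well defined and injective, and its image is the unital
subalgebra `P_m` of `gn` generated by `{r_A : ∅ ≠ A ⊆ I_m}`.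
-/

noncomputable section

open Finset

/-- Subsets of `I_m` viewed as subsets of `I_n` (via the order embedding `Fin m ↪ Fin n`). -/
def castSubset {m n : ℕ} (hmn : m ≤ n) (A : Finset (Fin m)) : Finset (Fin n) :=
  A.map (Fin.castLEEmb hmn)

lemma rGen_empty (k : Type) [Field k] (n : ℕ) : rGen k n ∅ = 0 := by
  simp [rGen]

lemma GnMk_rGen_mul_sub (k : Type) [Field k] (n : ℕ) {A : Finset (Fin n)} {i j : Fin n}
    (hi : i ∈ A) (hj : j ∈ A) :
    GnMk k n (rGen k n A) * (GnMk k n (rGen k n (A.erase i)) - GnMk k n (rGen k n (A.erase j)))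
      = 0 := by
  have h := RingQuot.mkAlgHom_rel k (GnRel.rel (k := k) A i j hi hj)
  simpa [hRel, GnMk] using h

lemma castSubset_injective {m n : ℕ} (hmn : m ≤ n) :
    Function.Injective (castSubset hmn) :=
  Finset.map_injective _

lemma castSubset_erase {m n : ℕ} (hmn : m ≤ n) (A : Finset (Fin m)) (i : Fin m) :
    castSubset hmn (A.erase i) = (castSubset hmn A).erase (Fin.castLEEmb hmn i) :=
  Finset.map_erase _ _ _

lemma castSubset_empty {m n : ℕ} (hmn : m ≤ n) : castSubset hmn ∅ = ∅ :=
  Finset.map_empty _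

/-- An algebra homomorphism out of `gn` from a family `f` of images of the generators `r_A`. -/
def gnLift (k : Type) [Field k] (n : ℕ) {B : Type} [Ring B] [Algebra k B]
    (f : Finset (Fin n) → B) (h0 : f ∅ = 0)
    (hf : ∀ A, ∀ i ∈ A, ∀ j ∈ A, f A * (f (A.erase i) - f (A.erase j)) = 0) :
    Gn k n →ₐ[k] B :=
  RingQuot.liftAlgHom k ⟨FreeAlgebra.lift k fun A : SubsetIdx n => f A.1, by
    have key (A : Finset (Fin n)) :
        FreeAlgebra.lift k (fun A : SubsetIdx n => f A.1) (rGen k n A) = f A := by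
      rcases A.eq_empty_or_nonempty with rfl | h
      · simp [rGen_empty, h0]
      · simp [rGen, h]
    rintro _ _ ⟨A, i, j, hi, hj⟩
    simpa [hRel, key] using hf A i hi j hj⟩

lemma gnLift_rGen (k : Type) [Field k] (n : ℕ) {B : Type} [Ring B] [Algebra k B]
    (f : Finset (Fin n) → B) (h0 : f ∅ = 0)
    (hf : ∀ A, ∀ i ∈ A, ∀ j ∈ A, f A * (f (A.erase i) - f (A.erase j)) = 0)
    (A : Finset (Fin n)) :
    gnLift k n f h0 hf (GnMk k n (rGen k n A)) = f A := by
  rcases A.eq_empty_or_nonempty with rfl | h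
  · simp [rGen_empty, h0]
  · simp [gnLift, GnMk, rGen, h]

lemma gn_adjoin_eq_top (k : Type) [Field k] (n : ℕ) :
    Algebra.adjoin k {x : Gn k n | ∃ A : Finset (Fin n), A.Nonempty ∧ x = GnMk k n (rGen k n A)}
      = ⊤ := by
  have h : {x : Gn k n | ∃ A : Finset (Fin n), A.Nonempty ∧ x = GnMk k n (rGen k n A)}
      = GnMk k n '' Set.range (FreeAlgebra.ι k) := by
    ext x
    constructor
    · rintro ⟨A, hA, rfl⟩
      exact ⟨_, ⟨⟨A, hA⟩, rfl⟩, by simp [rGen, hA]⟩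
    · rintro ⟨_, ⟨A, rfl⟩, rfl⟩
      exact ⟨A.1, A.2, by simp [rGen, A.2]⟩
  rw [h, ← AlgHom.map_adjoin, FreeAlgebra.adjoin_range_ι, Algebra.map_top, AlgHom.range_eq_top]
  exact RingQuot.mkAlgHom_surjective k _

/-- The homomorphism `gm → gn` sending `r_A` to `r_A`. -/
def gnIncl (k : Type) [Field k] {m n : ℕ} (hmn : m ≤ n) : Gn k m →ₐ[k] Gn k n :=
  gnLift k m (fun A => GnMk k n (rGen k n (castSubset hmn A)))
    (by simp [castSubset_empty, rGen_empty])
    (fun A i hi j hj => by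
      rw [castSubset_erase, castSubset_erase]
      exact GnMk_rGen_mul_sub k n (Finset.mem_map_of_mem _ hi) (Finset.mem_map_of_mem _ hj))

lemma gnIncl_rGen (k : Type) [Field k] {m n : ℕ} (hmn : m ≤ n) (A : Finset (Fin m)) :
    gnIncl k hmn (GnMk k m (rGen k m A)) = GnMk k n (rGen k n (castSubset hmn A)) :=
  gnLift_rGen ..

/-- The images of the generators of `gn` under the retraction to `gm`:
`r_A` goes to `r_A` when `A ⊆ I_m` and to `0` otherwise. -/
def gnRetractGen (k : Type) [Field k] {m n : ℕ} (hmn : m ≤ n) : Finset (Fin n) → Gn k m :=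
  Function.extend (castSubset hmn) (fun B => GnMk k m (rGen k m B)) 0

lemma gnRetractGen_castSubset (k : Type) [Field k] {m n : ℕ} (hmn : m ≤ n)
    (B : Finset (Fin m)) :
    gnRetractGen k hmn (castSubset hmn B) = GnMk k m (rGen k m B) :=
  (castSubset_injective hmn).extend_apply _ _ _

/-- The retraction `gn → gm` killing every `r_A` with `A ⊈ I_m`. -/
def gnRetract (k : Type) [Field k] {m n : ℕ} (hmn : m ≤ n) : Gn k n →ₐ[k] Gn k m :=
  gnLift k n (gnRetractGen k hmn)
    (by rw [← castSubset_empty hmn, gnRetractGen_castSubset, rGen_empty, map_zero])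
    (fun A i hi j hj => by
      by_cases hA : ∃ B, castSubset hmn B = A
      · obtain ⟨B, rfl⟩ := hA
        obtain ⟨i, hiB, rfl⟩ := Finset.mem_map.1 hi
        obtain ⟨j, hjB, rfl⟩ := Finset.mem_map.1 hj
        simp only [← castSubset_erase, gnRetractGen_castSubset]
        exact GnMk_rGen_mul_sub k m hiB hjB
      · rw [gnRetractGen, Function.extend_apply' _ _ _ hA, Pi.zero_apply, zero_mul])

lemma gnRetract_comp_gnIncl (k : Type) [Field k] {m n : ℕ} (hmn : m ≤ n) :
    (gnRetract k hmn).comp (gnIncl k hmn) = AlgHom.id k (Gn k m) := by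
  refine AlgHom.ext_of_adjoin_eq_top (gn_adjoin_eq_top k m) ?_
  rintro _ ⟨A, -, rfl⟩
  rw [AlgHom.comp_apply, gnIncl_rGen, gnRetract, gnLift_rGen, gnRetractGen_castSubset,
    AlgHom.id_apply]

theorem Gm_embeds_in_Gn (k : Type) [Field k] (m n : ℕ) (hm : 2 ≤ m) (hmn : m ≤ n) :
    ∃ φ : Gn k m →ₐ[k] Gn k n,
      (∀ A : Finset (Fin m),
        φ (GnMk k m (rGen k m A)) = GnMk k n (rGen k n (castSubset hmn A))) ∧
      Function.Injective φ ∧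
      φ.range = Algebra.adjoin k
        {x : Gn k n | ∃ A : Finset (Fin m), A.Nonempty ∧
          x = GnMk k n (rGen k n (castSubset hmn A))} := by
  refine ⟨gnIncl k hmn, gnIncl_rGen k hmn, ?_, ?_⟩
  · exact Function.LeftInverse.injective (g := gnRetract k hmn)
      (DFunLike.congr_fun (gnRetract_comp_gnIncl k hmn))
  · rw [← Algebra.map_top, ← gn_adjoin_eq_top, AlgHom.map_adjoin]
    congr 1
    ext x
    constructor
    · rintro ⟨_, ⟨A, hA, rfl⟩, rfl⟩
      exact ⟨A, hA, gnIncl_rGen k hmn A⟩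
    · rintro ⟨A, hA, rfl⟩
      exact ⟨_, ⟨A, hA, rfl⟩, gnIncl_rGen k hmn A⟩
end
end
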